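/- (Lemma 6.) In a finite discounted stochastic game, for any ε > 0 there exists ρ_ε > 0 such that if ρ^i ≤ ρ_ε for all i, then for every DM i, every deterministic joint policy (π_k^i, π_k^{-i}), and every deterministic policy π̂_k^i: |Q^i_{(π_k^i, π_k^{-i})} − Q^i_{(π_k^i, π̄_k^{-i})}|_∞ ≤ ε and |Q^i_{(π̂_k^i, π_k^{-i})} − Q^i_{(π̂_k^i, π̄_k^{-i})}|_∞ ≤ ε, where π̄_k^j = (1 − ρ^j)π_k^j + ρ^j ν^j and ν^j assigns the uniform distribution on U^j to every state. In particular, |Q^i_{(π_k^i, π_k^{-i})} − Q^i_{(π_k^i, π̄_k^{-i})}|_∞ ≤ (1 − Π_{j≠i}(1 − ρ^j)) · F̌ / (1 − β^i), where F̌ < ∞ is a uniform bound (over the relevant deterministic and perturbed policies) on the corresponding Bellman operator differences. -/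

import Mathlib

open MeasureTheory Filter
open scoped Classical

noncomputable section

namespace DQ

/-- A finite discounted stochastic game: `N` decision makers, finite state space `X`,
finite decision sets `U i`, cost functions `c`, discount factors `β`, transition kernel `P`. -/
structure Game (N : ℕ) (X : Type*) (U : Fin N → Type*) [Fintype X] where
  c : Fin N → X → (∀ i, U i) → ℝ
  β : Fin N → ℝ
  β_pos : ∀ i, 0 < β i
  β_lt_one : ∀ i, β i < 1
  P : X → (∀ i, U i) → X → ℝ
  P_nonneg : ∀ x u y, 0 ≤ P x u y
  P_sum_one : ∀ x u, ∑ y, P x u y = 1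

/-- The parameters of the learning algorithms (experimentation probabilities `ρ`,
inertias `lam`, tolerance levels `δ`, step sizes `α`, and the compact reset sets `Qset`). -/
structure Params (N : ℕ) (X : Type*) (U : Fin N → Type*)
    [Fintype X] [∀ i, Fintype (U i)] where
  ρ : Fin N → ℝ
  lam : Fin N → ℝ
  δ : Fin N → ℝ
  ρ_mem : ∀ i, 0 < ρ i ∧ ρ i < 1
  lam_mem : ∀ i, 0 < lam i ∧ lam i < 1
  δ_pos : ∀ i, 0 < δ i
  α : Fin N → ℕ → ℝ
  α_mem : ∀ i n, 0 ≤ α i n ∧ α i n ≤ 1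
  α_div : ∀ i, ¬ Summable (α i)
  α_sq : ∀ i, Summable fun n => α i n ^ 2
  Qset : (i : Fin N) → Set (X → U i → ℝ)
  Qset_compact : ∀ i, IsCompact (Qset i)
  Qset_nonempty : ∀ i, (Qset i).Nonempty

variable {N : ℕ} {X : Type*} {U : Fin N → Type*}
variable [Fintype X] [Nonempty X] [∀ i, Fintype (U i)] [∀ i, Nonempty (U i)]
variable [DecidableEq X] [∀ i, DecidableEq (U i)]

/-- A deterministic stationary policy of DM `i`, embedded as a randomized policy. -/
def detP {i : Fin N} (p : X → U i) : X → U i → ℝ := fun x a => if a = p x then 1 else 0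

/-- A deterministic joint policy viewed as a randomized policy profile. -/
def detJ (π : ∀ i, X → U i) : ∀ i, X → U i → ℝ := fun i => detP (π i)

/-- `σi` is a randomized stationary policy for DM `i`. -/
def IsRandPol {i : Fin N} (σi : X → U i → ℝ) : Prop :=
  ∀ x, (∀ a, 0 ≤ σi x a) ∧ ∑ a, σi x a = 1

/-- `σ` is a randomized stationary joint policy profile. -/
def IsProfile (σ : ∀ i, X → U i → ℝ) : Prop := ∀ i, IsRandPol (σ i)

/-- Probability of the joint decision `a` at state `x` under the profile `σ`. -/
def jointProb (σ : ∀ i, X → U i → ℝ) (x : X) (a : ∀ i, U i) : ℝ := ∏ i, σ i x (a i)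

/-- Point mass at `x`. -/
def dirac (x : X) : X → ℝ := fun y => if y = x then 1 else 0

/-- One-step evolution of the state distribution under the profile `σ`. -/
def stepOp (G : Game N X U) (σ : ∀ i, X → U i → ℝ) (μd : X → ℝ) : X → ℝ :=
  fun y => ∑ x, μd x * ∑ a, jointProb σ x a * G.P x a y

/-- Expected one-stage cost of DM `i` under the state distribution `μd` and profile `σ`. -/
def stageCost (G : Game N X U) (σ : ∀ i, X → U i → ℝ) (i : Fin N) (μd : X → ℝ) : ℝ :=
  ∑ x, μd x * ∑ a, jointProb σ x a * G.c i x a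

/-- Expected discounted cost `J^i_x(σ)` of DM `i`, starting at `x`, under the profile `σ`. -/
def J (G : Game N X U) (σ : ∀ i, X → U i → ℝ) (i : Fin N) (x : X) : ℝ :=
  ∑' t : ℕ, G.β i ^ t * stageCost G σ i ((stepOp G σ)^[t] (dirac x))

/-- `p` is a deterministic best reply of DM `i` to the profile `σ` (only the
components `σ j`, `j ≠ i`, matter): it attains the minimum of `J^i_x` over randomized
stationary policies simultaneously for every initial state `x`. -/
def IsBestReply (G : Game N X U) (i : Fin N) (σ : ∀ j, X → U j → ℝ) (p : X → U i) : Prop :=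
  ∀ (x : X) (σi : X → U i → ℝ), IsRandPol σi →
    J G (Function.update σ i (detP p)) i x ≤ J G (Function.update σ i σi) i x

/-- (Markov perfect) equilibrium among deterministic joint policies. -/
def IsEquilibrium (G : Game N X U) (π : ∀ i, X → U i) : Prop :=
  ∀ i, IsBestReply G i (detJ π) (π i)

/-- A strict best reply of DM `i` with respect to the deterministic joint policy `π`. -/
def IsStrictBestReply (G : Game N X U) (i : Fin N) (π : ∀ j, X → U j) (p : X → U i) : Prop :=
  IsBestReply G i (detJ π) p ∧
  ∃ x, J G (detJ (Function.update π i p)) i x < J G (detJ π) i x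

/-- A strict better reply of DM `i` with respect to the deterministic joint policy `π`. -/
def IsStrictBetterReply (G : Game N X U) (i : Fin N) (π : ∀ j, X → U j) (p : X → U i) : Prop :=
  (∀ x, J G (detJ (Function.update π i p)) i x ≤ J G (detJ π) i x) ∧
  ∃ x, J G (detJ (Function.update π i p)) i x < J G (detJ π) i x

/-- One step of a strict best reply path: exactly one DM deviates, to a strict best reply. -/
def StrictBRStep (G : Game N X U) (π π' : ∀ j, X → U j) : Prop :=
  ∃ i, π' = Function.update π i (π' i) ∧ π' i ≠ π i ∧ IsStrictBestReply G i π (π' i)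

/-- One step of a strict better reply path. -/
def StrictBetterStep (G : Game N X U) (π π' : ∀ j, X → U j) : Prop :=
  ∃ i, π' = Function.update π i (π' i) ∧ π' i ≠ π i ∧ IsStrictBetterReply G i π (π' i)

/-- One step of a multi-DM reply path: at least one DM deviates, and every deviating DM
switches to a reply of the kind specified by `rep`. -/
def MultiStep {N : ℕ} {X : Type*} {U : Fin N → Type*}
    (rep : (i : Fin N) → (∀ j, X → U j) → (X → U i) → Prop)
    (π π' : ∀ j, X → U j) : Prop :=
  π' ≠ π ∧ ∀ i, π' i ≠ π i → rep i π (π' i)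

/-- Weak acyclicity with respect to a step relation: from every deterministic joint policy
there is a finite path of steps ending at a deterministic equilibrium policy. -/
def WeaklyAcyclic (G : Game N X U)
    (step : (∀ j, X → U j) → (∀ j, X → U j) → Prop) : Prop :=
  ∀ π : ∀ j, X → U j, ∃ (L : ℕ) (p : ℕ → ∀ j, X → U j),
    p 0 = π ∧ (∀ k < L, step (p k) (p (k + 1))) ∧ IsEquilibrium G (p L)

/-- The optimal-Q Bellman operator `F^i_{σ^{-i}}` of DM `i` against the profile `σ`. -/
def Fopt (G : Game N X U) (σ : ∀ j, X → U j → ℝ) (i : Fin N) (Q : X → U i → ℝ) :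
    X → U i → ℝ :=
  fun x a => ∑ w : ∀ j, U j, (if w i = a then (1 : ℝ) else 0) *
    (∏ j ∈ Finset.univ.erase i, σ j x (w j)) *
    (G.c i x w + G.β i * ∑ y, G.P x w y * ⨅ v, Q y v)

/-- DM `i`'s optimal Q-factors `Q^i_{σ^{-i}}`: the unique fixed point of `Fopt`. -/
def optQ (G : Game N X U) (σ : ∀ j, X → U j → ℝ) (i : Fin N) : X → U i → ℝ :=
  if h : ∃ Q : X → U i → ℝ, Fopt G σ i Q = Q then h.choose else fun _ _ => 0

/-- The policy-evaluation Bellman operator `F^i_{(p, σ^{-i})}` used by Algorithm 2. -/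
def Feval (G : Game N X U) (σ : ∀ j, X → U j → ℝ) (i : Fin N) (p : X → U i)
    (Q : X → U i → ℝ) : X → U i → ℝ :=
  fun x a => ∑ w : ∀ j, U j, (if w i = a then (1 : ℝ) else 0) *
    (∏ j ∈ Finset.univ.erase i, σ j x (w j)) *
    (G.c i x w + G.β i * ∑ y, G.P x w y * Q y (p y))

/-- The Q-factors `Q^i_{(p, σ^{-i})}`: the unique fixed point of `Feval`. -/
def evalQ (G : Game N X U) (σ : ∀ j, X → U j → ℝ) (i : Fin N) (p : X → U i) :
    X → U i → ℝ :=
  if h : ∃ Q : X → U i → ℝ, Feval G σ i p Q = Q then h.choose else fun _ _ => 0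

/-- Maximum-norm distance between two Q-factor arrays. -/
def qdist {i : Fin N} (Q Q' : X → U i → ℝ) : ℝ := ⨆ x : X, ⨆ a : U i, |Q x a - Q' x a|

/-- The `ρ`-perturbation `π̄` of a deterministic joint policy `π`:
`π̄^j = (1 - ρ^j) π^j + ρ^j · (uniform on U^j)`. -/
def perturb (ρ : Fin N → ℝ) (π : ∀ j, X → U j) : ∀ j, X → U j → ℝ :=
  fun j x a => (1 - ρ j) * (if a = π j x then 1 else 0) + ρ j / (Fintype.card (U j) : ℝ)

/-- `δ̄`: the minimum separation between distinct entries of the optimal Q-factors over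
all DMs, states, decisions and deterministic joint policies. -/
def deltaBar (G : Game N X U) : ℝ :=
  sInf {d : ℝ | ∃ (i : Fin N) (x : X) (v w : U i) (π : ∀ j, X → U j),
    optQ G (detJ π) i x v ≠ optQ G (detJ π) i x w ∧
    d = |optQ G (detJ π) i x v - optQ G (detJ π) i x w|}

/-- `δ̌`: the minimum separation between distinct entries of the policy-evaluation
Q-factors (at the evaluated policies) over all DMs, states and deterministic policies. -/
def deltaCheck (G : Game N X U) : ℝ :=
  sInf {d : ℝ | ∃ (i : Fin N) (x : X) (p q : X → U i) (π : ∀ j, X → U j),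
    evalQ G (detJ π) i p x (p x) ≠ evalQ G (detJ π) i q x (q x) ∧
    d = |evalQ G (detJ π) i p x (p x) - evalQ G (detJ π) i q x (q x)|}

/-- Multi-step transition probability along a list of joint decisions. -/
def reachProb (G : Game N X U) : List (∀ i, U i) → X → X → ℝ
  | [], x, y => if y = x then 1 else 0
  | a :: rest, x, y => ∑ z, G.P x a z * reachProb G rest z y

/-- Assumption 1 (reachability): every state can be reached from every state with positive
probability by some finite sequence of joint decisions. -/
def Reachability (G : Game N X U) : Prop :=
  ∀ x y : X, ∃ us : List (∀ i, U i), us ≠ [] ∧ 0 < reachProb G us x y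

/-- The set of `d`-near best replies extracted from learnt Q-factors. -/
def nearBest {i : Fin N} (d : ℝ) (Q : X → U i → ℝ) : Set (X → U i) :=
  {p | ∀ x, Q x (p x) ≤ (⨅ v, Q x v) + d}

/-- Start time `t_k` of the `k`-th exploration phase: `t_0 = 0`, `t_{k+1} = t_k + T_k`. -/
def phaseStart (T : ℕ → ℕ) (k : ℕ) : ℕ := ∑ j ∈ Finset.range k, T j

/-- The number of visits of `(x_t, u_t^i)` during `[s, t)`. -/
def visits {Ω : Type*} (st : ℕ → Ω → X) (act : ℕ → Ω → ∀ i, U i) (i : Fin N)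
    (s t : ℕ) (ω : Ω) : ℕ :=
  ((Finset.Ico s t).filter fun r => st r ω = st t ω ∧ act r ω i = act t ω i).card

/-- One Q-learning update for DM `i` with step size `a` and continuation value `v`:
only the entry `(xt, ut^i)` is modified. -/
def qStepV (G : Game N X U) (i : Fin N) (a : ℝ) (Q : X → U i → ℝ) (xt : X)
    (ut : ∀ j, U j) (v : ℝ) : X → U i → ℝ :=
  fun x b => if x = xt ∧ b = ut i then
    (1 - a) * Q x b + a * (G.c i xt ut + G.β i * v) else Q x b

end DQ

namespace DQ

section Perturbation

variable {N : ℕ} {X : Type*} {U : Fin N → Type*}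
variable [∀ i, Fintype (U i)]

theorem one_sub_prod_one_sub_le {ρ : Fin N → ℝ} (hρ : ∀ j, 0 < ρ j ∧ ρ j < 1) {r : ℝ}
    (h : ∀ j, ρ j ≤ r) (s : Finset (Fin N)) :
    1 - ∏ j ∈ s, (1 - ρ j) ≤ N * r := by
  have h₁ : 1 - ∏ j ∈ s, (1 - ρ j) ≤ ∑ j ∈ s, ρ j := by
    induction s using Finset.induction_on with
    | empty => simp
    | insert j s hj ih =>
      rw [Finset.prod_insert hj, Finset.sum_insert hj]
      have : ∏ k ∈ s, (1 - ρ k) ≤ 1 :=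
        Finset.prod_le_one (fun k _ => sub_nonneg.2 (hρ k).2.le) fun k _ => by
          linarith [(hρ k).1]
      nlinarith [(hρ j).1]
  calc 1 - ∏ j ∈ s, (1 - ρ j) ≤ ∑ j, ρ j :=
        h₁.trans (Finset.sum_le_univ_sum_of_nonneg fun j => (hρ j).1.le)
    _ ≤ ∑ _j : Fin N, r := Finset.sum_le_sum fun j _ => h j
    _ = N * r := by simp

theorem qdist_le_dist [Fintype X] [Nonempty X] [∀ i, Nonempty (U i)] {i : Fin N} (Q Q' : X → U i → ℝ) :
    qdist Q Q' ≤ dist Q Q' :=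
  ciSup_le fun x => ciSup_le fun a => by
    rw [← Real.dist_eq]
    exact (dist_le_pi_dist (Q x) (Q' x) a).trans (dist_le_pi_dist Q Q' x)

variable [∀ i, DecidableEq (U i)]

/-- The probability that DM `i`'s opponents play `w` at state `x` under `σ`, restricted to those
joint decisions in which DM `i` plays `a`. -/
def oppWeight (σ : ∀ j, X → U j → ℝ) (i : Fin N) (x : X) (a : U i) (w : ∀ j, U j) : ℝ :=
  (if w i = a then (1 : ℝ) else 0) * ∏ j ∈ Finset.univ.erase i, σ j x (w j)

theorem oppWeight_nonneg {σ : ∀ j, X → U j → ℝ} (hσ : IsProfile σ) (i : Fin N) (x : X)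
    (a : U i) (w : ∀ j, U j) : 0 ≤ oppWeight σ i x a w :=
  mul_nonneg (by split_ifs <;> norm_num) (Finset.prod_nonneg fun j _ => (hσ j x).1 (w j))

theorem sum_oppWeight {σ : ∀ j, X → U j → ℝ} (hσ : IsProfile σ) (i : Fin N) (x : X)
    (a : U i) : ∑ w, oppWeight σ i x a w = 1 := by
  let f : ∀ j, U j → ℝ := Function.update (fun j => σ j x) i fun b => if b = a then 1 else 0
  have hf : ∀ w : ∀ j, U j, oppWeight σ i x a w = ∏ j, f j (w j) := by
    intro w
    rw [← Finset.mul_prod_erase _ _ (Finset.mem_univ i)]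
    have hi : f i (w i) = if w i = a then 1 else 0 := by simp [f]
    rw [hi, oppWeight]
    congr 1
    refine Finset.prod_congr rfl fun j hj => ?_
    simp [f, Function.update_of_ne (Finset.ne_of_mem_erase hj)]
  rw [Finset.sum_congr rfl fun w _ => hf w, ← Fintype.prod_sum]
  refine Finset.prod_eq_one fun j _ => ?_
  by_cases h : j = i
  · subst h
    simp [f]
  · simpa [f, h] using (hσ j x).2

theorem isProfile_detJ (π : ∀ j, X → U j) : IsProfile (detJ π) := by
  refine fun j x => ⟨fun a => ?_, ?_⟩
  · unfold detJ detP
    split_ifs <;> norm_num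
  · simp [detJ, detP]

theorem isProfile_perturb [∀ i, Nonempty (U i)] {ρ : Fin N → ℝ} (hρ : ∀ j, 0 < ρ j ∧ ρ j < 1)
    (π : ∀ j, X → U j) : IsProfile (perturb ρ π) := by
  refine fun j x => ⟨fun a => ?_, ?_⟩
  · have h₀ := (hρ j).1.le
    have h₁ := sub_nonneg.2 (hρ j).2.le
    unfold perturb
    positivity
  · have h : (Fintype.card (U j) : ℝ) ≠ 0 := by simp
    simp [perturb, Finset.sum_add_distrib, mul_div_cancel₀ _ h]

theorem prod_mul_oppWeight_detJ_le_perturb {ρ : Fin N → ℝ} (hρ : ∀ j, 0 < ρ j ∧ ρ j < 1)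
    (π : ∀ j, X → U j) (i : Fin N) (x : X) (a : U i) (w : ∀ j, U j) :
    (∏ j ∈ Finset.univ.erase i, (1 - ρ j)) * oppWeight (detJ π) i x a w
      ≤ oppWeight (perturb ρ π) i x a w := by
  rw [oppWeight, oppWeight, mul_left_comm, ← Finset.prod_mul_distrib]
  refine mul_le_mul_of_nonneg_left (Finset.prod_le_prod (fun j _ => ?_) fun j _ => ?_)
    (by split_ifs <;> norm_num)
  · exact mul_nonneg (sub_nonneg.2 (hρ j).2.le) ((isProfile_detJ π j x).1 _)
  · have := (hρ j).1.le
    simp only [detJ, detP, perturb]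
    exact le_add_of_nonneg_right (by positivity)

variable [Fintype X]

/-- The one-step cost plus discounted continuation value in `Feval`. -/
def lookahead (G : Game N X U) (i : Fin N) (p : X → U i) (Q : X → U i → ℝ) (x : X)
    (w : ∀ j, U j) : ℝ :=
  G.c i x w + G.β i * ∑ y, G.P x w y * Q y (p y)

theorem Feval_eq_sum (G : Game N X U) (σ : ∀ j, X → U j → ℝ) (i : Fin N) (p : X → U i)
    (Q : X → U i → ℝ) (x : X) (a : U i) :
    Feval G σ i p Q x a = ∑ w, oppWeight σ i x a w * lookahead G i p Q x w := rfl

/-- If `τ` puts at least `κ` times the weight of `σ` on every opponents' decision, then the two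
evaluation operators differ by at most `(1 - κ) * (2 * M)`. -/
theorem dist_Feval_le {G : Game N X U} {σ τ : ∀ j, X → U j → ℝ} (hσ : IsProfile σ)
    (hτ : IsProfile τ) {i : Fin N} {p : X → U i} {Q : X → U i → ℝ} {M κ : ℝ} (hM₀ : 0 ≤ M)
    (hM : ∀ x w, |lookahead G i p Q x w| ≤ M) (hκ : κ ≤ 1)
    (h : ∀ x a w, κ * oppWeight σ i x a w ≤ oppWeight τ i x a w) :
    dist (Feval G σ i p Q) (Feval G τ i p Q) ≤ (1 - κ) * (2 * M) := by
  have hr : 0 ≤ (1 - κ) * (2 * M) := mul_nonneg (sub_nonneg.2 hκ) (by positivity)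
  refine (dist_pi_le_iff hr).2 fun x => (dist_pi_le_iff hr).2 fun a => ?_
  rw [Real.dist_eq, Feval_eq_sum, Feval_eq_sum, ← Finset.sum_sub_distrib]
  calc |∑ w, (oppWeight σ i x a w * lookahead G i p Q x w
          - oppWeight τ i x a w * lookahead G i p Q x w)|
      ≤ ∑ w, ((1 - κ) * oppWeight σ i x a w
          + (oppWeight τ i x a w - κ * oppWeight σ i x a w)) * M := by
        refine (Finset.abs_sum_le_sum_abs _ _).trans (Finset.sum_le_sum fun w _ => ?_)
        rw [← sub_mul, abs_mul]
        have h₁ := mul_nonneg (sub_nonneg.2 hκ) (oppWeight_nonneg hσ i x a w)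
        have h₂ := h x a w
        exact mul_le_mul (abs_le.2 ⟨by linarith, by linarith⟩) (hM x w) (abs_nonneg _)
          (by linarith)
    _ = (1 - κ) * (2 * M) := by
        rw [← Finset.sum_mul, Finset.sum_add_distrib, Finset.sum_sub_distrib, ← Finset.mul_sum,
          ← Finset.mul_sum, sum_oppWeight hσ, sum_oppWeight hτ]
        ring

theorem dist_Feval_Feval_le (G : Game N X U) {σ : ∀ j, X → U j → ℝ} (hσ : IsProfile σ)
    (i : Fin N) (p : X → U i) (Q Q' : X → U i → ℝ) :
    dist (Feval G σ i p Q) (Feval G σ i p Q') ≤ G.β i * dist Q Q' := by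
  have hβ := (G.β_pos i).le
  have hr : 0 ≤ G.β i * dist Q Q' := mul_nonneg hβ dist_nonneg
  have hl : ∀ x w, |lookahead G i p Q x w - lookahead G i p Q' x w| ≤ G.β i * dist Q Q' := by
    intro x w
    have : lookahead G i p Q x w - lookahead G i p Q' x w
        = G.β i * ∑ y, G.P x w y * (Q y (p y) - Q' y (p y)) := by
      simp only [lookahead, mul_sub, Finset.sum_sub_distrib]
      ring
    rw [this, abs_mul, abs_of_nonneg hβ]
    refine mul_le_mul_of_nonneg_left ?_ hβ
    calc |∑ y, G.P x w y * (Q y (p y) - Q' y (p y))|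
        ≤ ∑ y, G.P x w y * dist Q Q' := by
          refine (Finset.abs_sum_le_sum_abs _ _).trans (Finset.sum_le_sum fun y _ => ?_)
          rw [abs_mul, abs_of_nonneg (G.P_nonneg x w y), ← Real.dist_eq]
          exact mul_le_mul_of_nonneg_left
            ((dist_le_pi_dist (Q y) (Q' y) (p y)).trans (dist_le_pi_dist Q Q' y))
            (G.P_nonneg x w y)
      _ = dist Q Q' := by rw [← Finset.sum_mul, G.P_sum_one, one_mul]
  refine (dist_pi_le_iff hr).2 fun x => (dist_pi_le_iff hr).2 fun a => ?_
  rw [Real.dist_eq, Feval_eq_sum, Feval_eq_sum, ← Finset.sum_sub_distrib]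
  calc |∑ w, (oppWeight σ i x a w * lookahead G i p Q x w
          - oppWeight σ i x a w * lookahead G i p Q' x w)|
      ≤ ∑ w, oppWeight σ i x a w * (G.β i * dist Q Q') := by
        refine (Finset.abs_sum_le_sum_abs _ _).trans (Finset.sum_le_sum fun w _ => ?_)
        rw [← mul_sub, abs_mul, abs_of_nonneg (oppWeight_nonneg hσ i x a w)]
        exact mul_le_mul_of_nonneg_left (hl x w) (oppWeight_nonneg hσ i x a w)
    _ = G.β i * dist Q Q' := by rw [← Finset.sum_mul, sum_oppWeight hσ, one_mul]

theorem Feval_evalQ (G : Game N X U) {σ : ∀ j, X → U j → ℝ} (hσ : IsProfile σ)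
    (i : Fin N) (p : X → U i) : Feval G σ i p (evalQ G σ i p) = evalQ G σ i p := by
  have hc : ContractingWith ⟨G.β i, (G.β_pos i).le⟩ (Feval G σ i p) :=
    ⟨G.β_lt_one i, LipschitzWith.of_dist_le_mul fun Q Q' => dist_Feval_Feval_le G hσ i p Q Q'⟩
  have h : ∃ Q, Feval G σ i p Q = Q := ⟨_, hc.fixedPoint_isFixedPt⟩
  rw [evalQ, dif_pos h]
  exact h.choose_spec

theorem dist_evalQ_le (G : Game N X U) {σ τ : ∀ j, X → U j → ℝ} (hσ : IsProfile σ)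
    (hτ : IsProfile τ) (i : Fin N) (p : X → U i) :
    dist (evalQ G σ i p) (evalQ G τ i p)
      ≤ dist (Feval G σ i p (evalQ G σ i p)) (Feval G τ i p (evalQ G σ i p)) / (1 - G.β i) := by
  rw [le_div_iff₀ (sub_pos.2 (G.β_lt_one i))]
  have h₁ := dist_triangle (Feval G σ i p (evalQ G σ i p)) (Feval G τ i p (evalQ G σ i p))
    (Feval G τ i p (evalQ G τ i p))
  have h₂ := dist_Feval_Feval_le G hτ i p (evalQ G σ i p) (evalQ G τ i p)
  rw [Feval_evalQ G hτ, Feval_evalQ G hσ] at h₁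
  rw [Feval_evalQ G hτ] at h₂
  rw [Feval_evalQ G hσ]
  linarith

theorem exists_lookahead_bound (G : Game N X U) :
    ∃ M : ℝ, 0 ≤ M ∧ ∀ (i : Fin N) (p : X → U i) (π : ∀ j, X → U j) (x : X) (w : ∀ j, U j),
      |lookahead G i p (evalQ G (detJ π) i p) x w| ≤ M := by
  let f : (Σ i : Fin N, (X → U i) × (∀ j, X → U j) × X × (∀ j, U j)) → ℝ := fun t =>
    |lookahead G t.1 t.2.1 (evalQ G (detJ t.2.2.1) t.1 t.2.1) t.2.2.2.1 t.2.2.2.2|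
  obtain ⟨M, hM⟩ := (Set.finite_range f).bddAbove
  exact ⟨max M 0, le_max_right _ _, fun i p π x w =>
    (hM ⟨⟨i, p, π, x, w⟩, rfl⟩).trans (le_max_left _ _)⟩

end Perturbation

/-- Lemma 6: (a) for any `ε > 0` there is `ρ_ε > 0` such that if all experimentation
probabilities are at most `ρ_ε`, then the Q-factors of any deterministic policy evaluated
against a deterministic joint policy and against its `ρ`-perturbation are within `ε`
(both for the baseline and the experimental policy); (b) quantitatively, the distance is
at most `(1 - Π_{j≠i}(1-ρ^j)) F̌ / (1 - β^i)` where `F̌ < ∞` is a uniform bound on the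
corresponding Bellman operator differences. -/
theorem stmt12
    {N : ℕ} {X : Type} {U : Fin N → Type}
    [Fintype X] [Nonempty X] [∀ i, Fintype (U i)] [∀ i, Nonempty (U i)]
    [DecidableEq X] [∀ i, DecidableEq (U i)]
    (G : Game N X U) :
    (∀ ε : ℝ, 0 < ε → ∃ ρε : ℝ, 0 < ρε ∧
      ∀ ρ : Fin N → ℝ, (∀ j, 0 < ρ j ∧ ρ j < 1) → (∀ j, ρ j ≤ ρε) →
        ∀ (i : Fin N) (p phat : X → U i) (π : ∀ j, X → U j),
          qdist (evalQ G (detJ π) i p) (evalQ G (perturb ρ π) i p) ≤ ε ∧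
          qdist (evalQ G (detJ π) i phat) (evalQ G (perturb ρ π) i phat) ≤ ε) ∧
    (∃ Fcheck : ℝ,
      (∀ (i : Fin N) (p : X → U i) (π : ∀ j, X → U j) (σ : ∀ j, X → U j → ℝ),
        IsProfile σ →
          qdist (Feval G (detJ π) i p (evalQ G (detJ π) i p))
            (Feval G σ i p (evalQ G (detJ π) i p)) ≤ Fcheck) ∧
      ∀ ρ : Fin N → ℝ, (∀ j, 0 < ρ j ∧ ρ j < 1) →
        ∀ (i : Fin N) (p : X → U i) (π : ∀ j, X → U j),
          qdist (evalQ G (detJ π) i p) (evalQ G (perturb ρ π) i p)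
            ≤ (1 - ∏ j ∈ Finset.univ.erase i, (1 - ρ j)) * Fcheck / (1 - G.β i)) := by
  obtain ⟨M, hM₀, hM⟩ := exists_lookahead_bound G
  have hκ : ∀ ρ : Fin N → ℝ, (∀ j, 0 < ρ j ∧ ρ j < 1) → ∀ i,
      ∏ j ∈ Finset.univ.erase i, (1 - ρ j) ≤ 1 := fun ρ hρ i =>
    Finset.prod_le_one (fun k _ => sub_nonneg.2 (hρ k).2.le) fun k _ => by linarith [(hρ k).1]
  have key : ∀ ρ : Fin N → ℝ, (∀ j, 0 < ρ j ∧ ρ j < 1) →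
      ∀ (i : Fin N) (p : X → U i) (π : ∀ j, X → U j),
        qdist (evalQ G (detJ π) i p) (evalQ G (perturb ρ π) i p)
          ≤ (1 - ∏ j ∈ Finset.univ.erase i, (1 - ρ j)) * (2 * M) / (1 - G.β i) := by
    intro ρ hρ i p π
    refine (qdist_le_dist _ _).trans ((dist_evalQ_le G (isProfile_detJ π)
      (isProfile_perturb hρ π) i p).trans ?_)
    have := sub_pos.2 (G.β_lt_one i)
    gcongr
    exact dist_Feval_le (isProfile_detJ π) (isProfile_perturb hρ π) hM₀ (hM i p π) (hκ ρ hρ i)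
      (prod_mul_oppWeight_detJ_le_perturb hρ π i)
  refine ⟨fun ε hε => ?_, 2 * M, fun i p π σ hσ => ?_, key⟩
  · have hpos : ∀ i, 0 ≤ 2 * M / (1 - G.β i) := fun i =>
      div_nonneg (by positivity) (sub_nonneg.2 (G.β_lt_one i).le)
    set K : ℝ := ∑ i, 2 * M / (1 - G.β i) with hK
    have hK₀ : 0 ≤ K := Finset.sum_nonneg fun i _ => hpos i
    have hr : 0 < ε / (N * K + 1) := by positivity
    refine ⟨ε / (N * K + 1), hr, fun ρ hρ hle i p phat π => ?_⟩
    have hε' : (1 - ∏ j ∈ Finset.univ.erase i, (1 - ρ j)) * (2 * M) / (1 - G.β i) ≤ ε :=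
      calc (1 - ∏ j ∈ Finset.univ.erase i, (1 - ρ j)) * (2 * M) / (1 - G.β i)
          = (1 - ∏ j ∈ Finset.univ.erase i, (1 - ρ j)) * (2 * M / (1 - G.β i)) :=
            mul_div_assoc _ _ _
        _ ≤ (N * (ε / (N * K + 1))) * K :=
            mul_le_mul (one_sub_prod_one_sub_le hρ hle _)
              (Finset.single_le_sum (fun i _ => hpos i) (Finset.mem_univ i)) (hpos i)
              (by positivity)
        _ = ε * (N * K) / (N * K + 1) := by ring
        _ ≤ ε := by
            rw [div_le_iff₀ (by positivity)]
            nlinarith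
    exact ⟨(key ρ hρ i p π).trans hε', (key ρ hρ i phat π).trans hε'⟩
  · refine (qdist_le_dist _ _).trans ?_
    simpa using dist_Feval_le (κ := 0) (isProfile_detJ π) hσ hM₀ (hM i p π) zero_le_one
      fun x a w => by simpa using oppWeight_nonneg hσ i x a w

end DQ
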